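/- arXiv:2301.08066 — 3 statements merged into one kernel-verified Lean document; each statement's English description precedes it below -/
import Mathlib

section
/- Let x, α be real numbers with x ≥ 1 and α > f(x), where f is the piecewise function f(x) = x + 1/2 for 0 < x < 1, f(x) = √(2x + 1/4) for 1 ≤ x < 15/8, f(x) = (2/3)x + 3/4 for 15/8 ≤ x < 9/4, f(x) = (1/3)x + 3/2 for 9/4 ≤ x < 3, and f(x) = (1/2)x + 1 for x ≥ 3. Then α² > 2x, and setting b₁ := α + √(α² − 2x) and b₂ := α − √(α² − 2x), the following three conditions hold: (i) 0 < b₂ < 2; (ii) b₁ − b₂ > 1; (iii) for every pair of nonnegative integers (r, c) with b₁·r ≤ c and c ≤ b₂·(r + 1), either (r, c) = (0, 0) or (r, c) = (0, 1). -/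
/-- The piecewise function f from the paper. -/
noncomputable def f (x : ℝ) : ℝ :=
  if x < 1 then x + 1/2
  else if x < 15/8 then Real.sqrt (2*x + 1/4)
  else if x < 9/4 then (2/3)*x + 3/4
  else if x < 3 then (1/3)*x + 3/2
  else (1/2)*x + 1

theorem two_mul_add_quarter_lt_sq_of_f_lt {x α : ℝ} (hx : 1 ≤ x) (hα : f x < α) :
    0 < α ∧ 2 * x + 1 / 4 < α ^ 2 := by
  have key : ∀ y : ℝ, 0 < y → y < α → 2 * x + 1 / 4 ≤ y ^ 2 → 0 < α ∧ 2 * x + 1 / 4 < α ^ 2 :=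
    fun y hy hyα h => ⟨hy.trans hyα, by nlinarith⟩
  unfold f at hα
  split_ifs at hα with h1 h2 h3 h4
  · linarith
  · exact key _ (Real.sqrt_pos.mpr (by linarith)) hα (Real.sq_sqrt (by linarith)).ge
  · exact key _ (by linarith) hα (by nlinarith)
  · exact key _ (by linarith) hα (by nlinarith)
  · exact key _ (by linarith) hα (by nlinarith)

theorem half_mul_add_one_lt_of_f_lt {x α : ℝ} (hx : 1 ≤ x) (hα : f x < α) :
    x / 2 + 1 < α := by
  unfold f at hα
  split_ifs at hα with h1 h2 h3 h4
  · linarith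
  · exact (Real.le_sqrt_of_sq_le (by nlinarith)).trans_lt hα
  all_goals linarith

/-- The lines `w = α b - x` through the points of the parabola `w = b ^ 2 / 2` with `b = 3` and
`b = 3 / 2` are the ones excluded by the middle pieces of `f`. -/
theorem not_le_three_and_three_halves_le {x α s : ℝ} (hx : 1 ≤ x) (hα : f x < α)
    (hs : s ^ 2 = α ^ 2 - 2 * x) (hs' : 1 / 2 < s) (hb : α - s < 2) :
    ¬ (α + s ≤ 3 ∧ 3 / 2 ≤ α - s) := by
  rintro ⟨h3, h32⟩
  unfold f at hα
  split_ifs at hα with h1 h2 h4 h5 <;> nlinarith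

/-- If x ≥ 1 and α > f(x), then α² > 2x and, with b₁ = α + √(α²−2x) and
b₂ = α − √(α²−2x), one has (i) 0 < b₂ < 2, (ii) b₁ − b₂ > 1, and (iii) any pair of
nonnegative integers (r,c) with b₁·r ≤ c ≤ b₂·(r+1) is (0,0) or (0,1). -/
theorem conditions_hold_of_f_lt (x α : ℝ) (hx : 1 ≤ x) (hα : f x < α) :
    2*x < α^2 ∧
    (let b₁ : ℝ := α + Real.sqrt (α^2 - 2*x)
     let b₂ : ℝ := α - Real.sqrt (α^2 - 2*x)
     (0 < b₂ ∧ b₂ < 2) ∧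
     1 < b₁ - b₂ ∧
     (∀ r c : ℕ, b₁ * r ≤ c → (c : ℝ) ≤ b₂ * (r + 1) →
        (r = 0 ∧ c = 0) ∨ (r = 0 ∧ c = 1))) := by
  obtain ⟨hα0, hsq⟩ := two_mul_add_quarter_lt_sq_of_f_lt hx hα
  have hhalf := half_mul_add_one_lt_of_f_lt hx hα
  refine ⟨by linarith, ?_⟩
  intro b₁ b₂
  obtain ⟨s, hs⟩ : ∃ s, s = Real.sqrt (α^2 - 2*x) := ⟨_, rfl⟩
  have hss : s ^ 2 = α ^ 2 - 2 * x := by rw [hs, Real.sq_sqrt (by linarith)]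
  have hs0 : 0 ≤ s := hs ▸ Real.sqrt_nonneg _
  have hb₁ : b₁ = α + s := by rw [hs]
  have hb₂ : b₂ = α - s := by rw [hs]
  clear_value b₁ b₂
  subst hb₁ hb₂
  have hs' : 1 / 2 < s := by nlinarith
  have hlt : s < α := by nlinarith
  have hb : α - s < 2 := by nlinarith
  refine ⟨⟨by linarith, hb⟩, by linarith, fun r c h₁ h₂ => ?_⟩
  have hr : r < 2 := by
    have : (r : ℝ) < 2 := by nlinarith [(Nat.cast_nonneg r : (0 : ℝ) ≤ r)]
    exact_mod_cast this
  interval_cases r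
  · have hc : (c : ℝ) < 2 := by push_cast at h₂; linarith
    have hc' : c < 2 := by exact_mod_cast hc
    omega
  · exfalso
    push_cast at h₁ h₂
    have hc₄ : (c : ℝ) < 4 := by linarith
    have hc₂ : (2 : ℝ) < c := by linarith
    have hc : c = 3 := by
      have h4 : c < 4 := by exact_mod_cast hc₄
      have h2 : 2 < c := by exact_mod_cast hc₂
      omega
    subst hc
    push_cast at h₁ h₂
    exact not_le_three_and_three_halves_le hx hα hss hs' hb ⟨by linarith, by linarith⟩
end

section
/- Let f be the piecewise function with f(x) = x + 1/2 for 0 < x < 1, f(x) = √(2x + 1/4) for 1 ≤ x < 15/8, f(x) = (2/3)x + 3/4 for 15/8 ≤ x < 9/4, f(x) = (1/3)x + 3/2 for 9/4 ≤ x < 3, f(x) = (1/2)x + 1 for x ≥ 3, and let Ψ(x, x′, α) := (1/2)(x − x′)² + (1/2)(x + x′) − (2/3)αx + (1/2)x′² + (1/2)x′. Then for every real κ > 0 and every real B, there exists a real X such that for all x ≥ X, setting α := (3/4)(x + 1) − 3B/(2κx), the three optimality conditions hold: f(x) < α, Ψ(x, 1/κ, α) < 0, and Ψ(x, x − α + 1/2,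 α) < 0. (This is the arithmetic core of the existence of a spectral-flow parameter ε(β₀, m₀) beyond which the class is optimal and the minimal rank-zero DT invariant is given by a single PT invariant.) -/
/-- The function Ψ: rescaled difference between the upper and lower bounds on m'. -/
noncomputable def Psi (x x' α : ℝ) : ℝ :=
  (1/2)*(x - x')^2 + (1/2)*(x + x') - (2/3)*α*x + (1/2)*x'^2 + (1/2)*x'

/-- For every κ > 0 and every B, for all sufficiently large x, setting
α = (3/4)(x+1) − 3B/(2κx), the three optimality conditions hold. -/
theorem eventually_optimal (κ B : ℝ) (hκ : 0 < κ) :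
    ∃ X : ℝ, ∀ x : ℝ, X ≤ x →
      (let α : ℝ := (3/4)*(x + 1) - 3*B/(2*κ*x)
       f x < α ∧ Psi x (1/κ) α < 0 ∧ Psi x (x - α + 1/2) α < 0) := by
  set k : ℝ := 1 / κ with hk
  have hkpos : 0 < k := by positivity
  refine ⟨100 + k + 2 * |B| + 2 * |B * k|, fun x hx => ?_⟩
  have hB := abs_le.mp (le_refl |B|)
  have hBk := abs_le.mp (le_refl |B * k|)
  have hB0 := abs_nonneg B
  have hBk0 := abs_nonneg (B * k)
  have hx100 : 100 ≤ x := by linarith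
  have hx0 : 0 < x := by linarith
  obtain ⟨d, hd⟩ : ∃ d, d = 3 * B / (2 * κ * x) := ⟨_, rfl⟩
  have hdx : d * x = 3 / 2 * (B * k) := by
    rw [hd, hk]
    field_simp
  have hd_le : d ≤ 1 := le_of_mul_le_mul_right (by linarith) hx0
  have hd_ge : -1 ≤ d := le_of_mul_le_mul_right (by linarith) hx0
  rw [← hd]
  refine ⟨?_, ?_, ?_⟩
  · rw [f, if_neg (by linarith), if_neg (by linarith), if_neg (by linarith),
      if_neg (by linarith)]
    linarith
  · have hPsi : Psi x k (3 / 4 * (x + 1) - d) = k * (k + 1 + B - x) := by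
      rw [Psi]
      linear_combination (2 / 3) * hdx
    rw [hPsi]
    exact mul_neg_of_pos_of_neg hkpos (by linarith)
  · rw [Psi]
    nlinarith [mul_nonneg (sub_nonneg.mpr hd_le) (sub_nonneg.mpr hd_ge)]
end

section
/- Let f be the piecewise function with f(x) = x + 1/2 for 0 < x < 1, f(x) = √(2x + 1/4) for 1 ≤ x < 15/8, f(x) = (2/3)x + 3/4 for 15/8 ≤ x < 9/4, f(x) = (1/3)x + 3/2 for 9/4 ≤ x < 3, f(x) = (1/2)x + 1 for x ≥ 3, and let Ψ(x, x′, α) := (1/2)(x − x′)² + (1/2)(x + x′) − (2/3)αx + (1/2)x′² + (1/2)x′. Then for all real x and α with x > (5 + √7)/4 and f(x) < α ≤ x + 1/2, one has Ψ(x, x − α + 1/2, α) < 0. (That is, the third optimality condition is implied by the condition α > f(x) when x > (5 + √7)/4, for α in the meaningful range α ≤ x + 1/2.) -/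
theorem monic_quadratic_neg_of_mem_Ioc {p r a b t : ℝ} (ha : a ^ 2 + p * a + r ≤ 0)
    (hb : b ^ 2 + p * b + r < 0) (hat : a < t) (htb : t ≤ b) : t ^ 2 + p * t + r < 0 := by
  have hab : 0 < b - a := by linarith
  have key : (b - a) * (t ^ 2 + p * t + r) = (b - t) * (a ^ 2 + p * a + r)
      + (t - a) * (b ^ 2 + p * b + r) - (t - a) * (b - t) * (b - a) := by ring
  have hleft : (b - t) * (a ^ 2 + p * a + r) ≤ 0 :=
    mul_nonpos_of_nonneg_of_nonpos (by linarith) ha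
  have hright : (t - a) * (b ^ 2 + p * b + r) < 0 := mul_neg_of_pos_of_neg (by linarith) hb
  have hgap : 0 ≤ (t - a) * (b - t) * (b - a) :=
    mul_nonneg (mul_nonneg (by linarith) (by linarith)) hab.le
  exact neg_of_mul_neg_right (by linarith) hab.le

theorem Psi_sub_add_half (x α : ℝ) :
    Psi x (x - α + 1/2) α
      = α ^ 2 + (-2 - 5/3 * x) * α + (x ^ 2 / 2 + 2 * x + 3/4) := by
  unfold Psi
  ring

/-- For x > (5 + √7)/4 and f(x) < α ≤ x + 1/2, the third optimality condition
Ψ(x, x − α + 1/2, α) < 0 holds. -/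
theorem third_condition_implied (x α : ℝ) (hx : (5 + Real.sqrt 7)/4 < x)
    (h1 : f x < α) (h2 : α ≤ x + 1/2) :
    Psi x (x - α + 1/2) α < 0 := by
  have hs : 5/2 < Real.sqrt 7 := Real.lt_sqrt_of_sq_lt (by norm_num)
  have hs2 : Real.sqrt 7 ^ 2 = 7 := Real.sq_sqrt (by norm_num)
  rw [Psi_sub_add_half]
  refine monic_quadratic_neg_of_mem_Ioc ?_ ?_ h1 h2
  · unfold f
    split_ifs
    · linarith
    · linarith
    · nlinarith [mul_pos (sub_pos.2 hx) (show 0 < x - (5 - Real.sqrt 7)/4 by linarith)]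
    · nlinarith
    · nlinarith
  · nlinarith
end
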